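/- Fix an integer e ≥ 2 and κ = (κ₁, κ₂) ∈ (ℤ/eℤ)². Suppose λ is a bipartition with wt(λ) = 3 and i, j ∈ ℤ/eℤ satisfy i ≠ j, δ_i(λ) ≥ 1 and δ_j(λ) ≥ 2. Then λ does not have both an addable i-node and an addable j-node. -/

import Mathlib

namespace Wt3

/-- `f : ℕ → ℕ` (0-indexed: `f r` is the `(r+1)`-th part `λ_{r+1}`) is a partition if it is
weakly decreasing with finitely many nonzero terms. -/
def IsPartition (f : ℕ → ℕ) : Prop :=
  (∀ r, f (r + 1) ≤ f r) ∧ ∃ N, ∀ r, N ≤ r → f r = 0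

/-- A bipartition: an ordered pair of partitions, given as `lam : Fin 2 → ℕ → ℕ`. -/
def IsBipartition (lam : Fin 2 → ℕ → ℕ) : Prop := ∀ a, IsPartition (lam a)

/-- Nodes `(r, c, a)` with 0-indexed row `r`, column `c`, and component `a : Fin 2`. -/
abbrev Node := ℕ × ℕ × Fin 2

/-- The Young diagram of a bipartition: `(r,c,a)` is a node iff `c < λ⁽ᵃ⁾_r` (0-indexed,
corresponding to `c+1 ≤ λ⁽ᵃ⁾_{r+1}` in 1-indexed terms). -/
def Diagram (lam : Fin 2 → ℕ → ℕ) : Set Node := {x | x.2.1 < lam x.2.2 x.1}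

/-- A node of `[λ]` is removable if deleting it leaves the Young diagram of a bipartition. -/
def IsRemovable (lam : Fin 2 → ℕ → ℕ) (x : Node) : Prop :=
  x ∈ Diagram lam ∧ ∃ mu, IsBipartition mu ∧ Diagram mu = Diagram lam \ {x}

/-- A node not in `[λ]` is addable if adding it gives the Young diagram of a bipartition. -/
def IsAddable (lam : Fin 2 → ℕ → ℕ) (x : Node) : Prop :=
  x ∉ Diagram lam ∧ ∃ mu, IsBipartition mu ∧ Diagram mu = Diagram lam ∪ {x}

/-- The residue `c − r + κ_a ∈ ℤ/eℤ` of a node `(r,c,a)` (0-indexing leaves this unchanged). -/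
def res (e : ℕ) (κ : Fin 2 → ZMod e) (x : Node) : ZMod e :=
  (x.2.1 : ZMod e) - (x.1 : ZMod e) + κ x.2.2

/-- `c_i(λ)`: the number of `i`-nodes of `λ`. -/
noncomputable def cnt (e : ℕ) (κ : Fin 2 → ZMod e) (lam : Fin 2 → ℕ → ℕ) (i : ZMod e) : ℕ :=
  Set.ncard {x : Node | x ∈ Diagram lam ∧ res e κ x = i}

/-- The number of removable `i`-nodes of `λ`. -/
noncomputable def remCount (e : ℕ) (κ : Fin 2 → ZMod e) (lam : Fin 2 → ℕ → ℕ) (i : ZMod e) : ℕ :=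
  Set.ncard {x : Node | IsRemovable lam x ∧ res e κ x = i}

/-- The number of addable `i`-nodes of `λ`. -/
noncomputable def addCount (e : ℕ) (κ : Fin 2 → ZMod e) (lam : Fin 2 → ℕ → ℕ) (i : ZMod e) : ℕ :=
  Set.ncard {x : Node | IsAddable lam x ∧ res e κ x = i}

/-- `δ_i(λ)`: number of removable `i`-nodes minus number of addable `i`-nodes. -/
noncomputable def delta (e : ℕ) (κ : Fin 2 → ZMod e) (lam : Fin 2 → ℕ → ℕ) (i : ZMod e) : ℤ :=
  (remCount e κ lam i : ℤ) - (addCount e κ lam i : ℤ)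

/-- The weight `wt(λ) = c_{κ₁}(λ) + c_{κ₂}(λ) − ½ Σ_{i ∈ ℤ/eℤ} (c_i(λ) − c_{i+1}(λ))²`. -/
noncomputable def wt (e : ℕ) (κ : Fin 2 → ZMod e) (lam : Fin 2 → ℕ → ℕ) : ℚ :=
  (cnt e κ lam (κ 0) : ℚ) + (cnt e κ lam (κ 1) : ℚ) -
    (1 / 2) * ∑ j ∈ Finset.range e,
      ((cnt e κ lam (j : ZMod e) : ℚ) - (cnt e κ lam ((j : ZMod e) + 1) : ℚ)) ^ 2

/-- The rim of `λ`: nodes `(r,c,a) ∈ [λ]` with `(r+1,c+1,a) ∉ [λ]`. -/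
def Rim (lam : Fin 2 → ℕ → ℕ) : Set Node :=
  {x | x ∈ Diagram lam ∧ (x.1 + 1, x.2.1 + 1, x.2.2) ∉ Diagram lam}

/-- One step along a strip: `y` is one step to the right of, or one step above, `x`
(in the same component). -/
def Step (x y : Node) : Prop :=
  y.2.2 = x.2.2 ∧ ((y.1 = x.1 ∧ y.2.1 = x.2.1 + 1) ∨ (x.1 = y.1 + 1 ∧ y.2.1 = x.2.1))

/-- A rim hook of `λ`: a nonempty subset of the rim, contained in a single component,
forming a connected strip, whose removal leaves the Young diagram of a bipartition. -/
def IsRimHook (lam : Fin 2 → ℕ → ℕ) (H : Finset Node) : Prop :=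
  H.Nonempty ∧ ↑H ⊆ Rim lam ∧ (∀ x ∈ H, ∀ y ∈ H, x.2.2 = y.2.2) ∧
    (∃ l : List Node, l.Chain' Step ∧ ∀ x : Node, x ∈ l ↔ x ∈ H) ∧
    ∃ mu, IsBipartition mu ∧ Diagram mu = Diagram lam \ ↑H

/-- A bicore: a bipartition with no rim `e`-hooks. -/
def IsBicore (e : ℕ) (lam : Fin 2 → ℕ → ℕ) : Prop :=
  ¬ ∃ H : Finset Node, IsRimHook lam H ∧ H.card = e

/-- The beta-set `{λ_r + k − r : 1 ≤ r ≤ k}` of a partition with charge `k` (0-indexed form). -/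
def betaSet (f : ℕ → ℕ) (k : ℕ) : Finset ℕ :=
  (Finset.range k).image fun r => f r + (k - (r + 1))

/-- The number of nonzero parts of a partition. -/
noncomputable def len (f : ℕ → ℕ) : ℕ := Set.ncard {r : ℕ | f r ≠ 0}

/-- `(k₁,k₂)` is a bicharge for `κ` relative to `λ`. -/
def IsBicharge (e : ℕ) (κ : Fin 2 → ZMod e) (lam : Fin 2 → ℕ → ℕ) (k₁ k₂ : ℕ) : Prop :=
  (k₁ : ZMod e) = κ 0 ∧ (k₂ : ZMod e) = κ 1 ∧ len (lam 0) ≤ k₁ ∧ len (lam 1) ≤ k₂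

/-- `γ_x(λ)`: beads of residue `x` in the first beta-set minus those in the second. -/
def gamma (e : ℕ) (lam : Fin 2 → ℕ → ℕ) (k₁ k₂ : ℕ) (x : ZMod e) : ℤ :=
  (((betaSet (lam 0) k₁).filter fun b : ℕ => (b : ZMod e) = x).card : ℤ) -
    (((betaSet (lam 1) k₂).filter fun b : ℕ => (b : ZMod e) = x).card : ℤ)

/-- `x` is above (higher than) `y`. -/
def Above (x y : Node) : Prop := x.2.2 < y.2.2 ∨ (x.2.2 = y.2.2 ∧ x.1 < y.1)

/-- A normal `i`-node: a removable `i`-node `x` such that for every addable `i`-node `y`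
below `x`, the removable `i`-nodes strictly between `x` and `y` outnumber the addable ones
(equivalently, the `−` sign of `x` survives in the reduced `i`-signature). -/
def IsNormal (e : ℕ) (κ : Fin 2 → ZMod e) (lam : Fin 2 → ℕ → ℕ) (i : ZMod e) (x : Node) :
    Prop :=
  IsRemovable lam x ∧ res e κ x = i ∧
    ∀ y : Node, IsAddable lam y → res e κ y = i → Above x y →
      Set.ncard {z : Node | IsAddable lam z ∧ res e κ z = i ∧ Above x z ∧ Above z y} <
        Set.ncard {z : Node | IsRemovable lam z ∧ res e κ z = i ∧ Above x z ∧ Above z y}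

/-- The good `i`-node: the highest normal `i`-node. -/
def IsGood (e : ℕ) (κ : Fin 2 → ZMod e) (lam : Fin 2 → ℕ → ℕ) (i : ZMod e) (x : Node) :
    Prop :=
  IsNormal e κ lam i x ∧ ∀ y, IsNormal e κ lam i y → y = x ∨ Above x y

/-- An antinormal `i`-node: a removable `i`-node `x` such that for every addable `i`-node `y`
above `x`, the removable `i`-nodes strictly between `y` and `x` outnumber the addable ones
(equivalently, the `−` sign of `x` survives in the antireduced `i`-signature). -/
def IsAntinormal (e : ℕ) (κ : Fin 2 → ZMod e) (lam : Fin 2 → ℕ → ℕ) (i : ZMod e) (x : Node) :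
    Prop :=
  IsRemovable lam x ∧ res e κ x = i ∧
    ∀ y : Node, IsAddable lam y → res e κ y = i → Above y x →
      Set.ncard {z : Node | IsAddable lam z ∧ res e κ z = i ∧ Above y z ∧ Above z x} <
        Set.ncard {z : Node | IsRemovable lam z ∧ res e κ z = i ∧ Above y z ∧ Above z x}

/-- The antigood `i`-node: the lowest antinormal `i`-node. -/
def IsAntigood (e : ℕ) (κ : Fin 2 → ZMod e) (lam : Fin 2 → ℕ → ℕ) (i : ZMod e) (x : Node) :
    Prop :=
  IsAntinormal e κ lam i x ∧ ∀ y, IsAntinormal e κ lam i y → y = x ∨ Above y x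

/-- `μ →ᵢ λ`: `μ` is obtained from `λ` by removing the good `i`-node. -/
def RemGoodAt (e : ℕ) (κ : Fin 2 → ZMod e) (i : ZMod e) (mu lam : Fin 2 → ℕ → ℕ) : Prop :=
  ∃ x, IsGood e κ lam i x ∧ Diagram mu = Diagram lam \ {x}

/-- `μ ⇒ᵢ λ`: `μ` is obtained from `λ` by removing the antigood `i`-node. -/
def RemAntigoodAt (e : ℕ) (κ : Fin 2 → ZMod e) (i : ZMod e) (mu lam : Fin 2 → ℕ → ℕ) : Prop :=
  ∃ x, IsAntigood e κ lam i x ∧ Diagram mu = Diagram lam \ {x}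

/-- `μ → λ`: `μ` is obtained from the bipartition `λ` by removing a good node. -/
def RemGood (e : ℕ) (κ : Fin 2 → ZMod e) (mu lam : Fin 2 → ℕ → ℕ) : Prop :=
  IsBipartition mu ∧ IsBipartition lam ∧ ∃ i, RemGoodAt e κ i mu lam

/-- A bipartition is restricted if it lies in the class of the empty bipartition under the
equivalence relation generated by `→`. -/
def IsRestricted (e : ℕ) (κ : Fin 2 → ZMod e) (lam : Fin 2 → ℕ → ℕ) : Prop :=
  Relation.EqvGen (RemGood e κ) lam (fun _ _ => 0)

/-- A partition is `e`-restricted if `λ_r − λ_{r+1} < e` for all `r`. -/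
def IsERestricted (e : ℕ) (f : ℕ → ℕ) : Prop := ∀ r, f r < f (r + 1) + e

/-- The conjugate partition: `λ′_r = #{c : λ_c ≥ r}` (0-indexed form). -/
noncomputable def conjP (f : ℕ → ℕ) : ℕ → ℕ := fun r => Set.ncard {c : ℕ | r + 1 ≤ f c}

/-- The conjugate bipartition `λ′ = ((λ⁽²⁾)′ | (λ⁽¹⁾)′)`. -/
noncomputable def conjB (lam : Fin 2 → ℕ → ℕ) : Fin 2 → ℕ → ℕ := fun a => conjP (lam (1 - a))

/-- `|λ|` for a partition. -/
noncomputable def psize (f : ℕ → ℕ) : ℕ := Set.ncard {p : ℕ × ℕ | p.2 < f p.1}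

/-- `|λ|` for a bipartition. -/
noncomputable def bsize (lam : Fin 2 → ℕ → ℕ) : ℕ := psize (lam 0) + psize (lam 1)

/-- `λ_1 + ⋯ + λ_r`. -/
def psum (f : ℕ → ℕ) (r : ℕ) : ℕ := ∑ j ∈ Finset.range r, f j

/-- The dominance order on bipartitions: `λ ⊵ μ`. -/
def Dominates (lam mu : Fin 2 → ℕ → ℕ) : Prop :=
  ∀ r : ℕ, psum (mu 0) r ≤ psum (lam 0) r ∧
    psize (mu 0) + psum (mu 1) r ≤ psize (lam 0) + psum (lam 1) r

/-! Single-partition versions (for statement 11). -/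

abbrev Node1 := ℕ × ℕ

def Diagram1 (f : ℕ → ℕ) : Set Node1 := {x | x.2 < f x.1}

def IsRemovable1 (f : ℕ → ℕ) (x : Node1) : Prop :=
  x ∈ Diagram1 f ∧ ∃ g, IsPartition g ∧ Diagram1 g = Diagram1 f \ {x}

def IsAddable1 (f : ℕ → ℕ) (x : Node1) : Prop :=
  x ∉ Diagram1 f ∧ ∃ g, IsPartition g ∧ Diagram1 g = Diagram1 f ∪ {x}

def res1 (e : ℕ) (k : ZMod e) (x : Node1) : ZMod e := (x.2 : ZMod e) - (x.1 : ZMod e) + k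

def Rim1 (f : ℕ → ℕ) : Set Node1 := {x | x ∈ Diagram1 f ∧ (x.1 + 1, x.2 + 1) ∉ Diagram1 f}

def Step1 (x y : Node1) : Prop :=
  (y.1 = x.1 ∧ y.2 = x.2 + 1) ∨ (x.1 = y.1 + 1 ∧ y.2 = x.2)

def IsRimHook1 (f : ℕ → ℕ) (H : Finset Node1) : Prop :=
  H.Nonempty ∧ ↑H ⊆ Rim1 f ∧
    (∃ l : List Node1, l.Chain' Step1 ∧ ∀ x : Node1, x ∈ l ↔ x ∈ H) ∧
    ∃ g, IsPartition g ∧ Diagram1 g = Diagram1 f \ ↑H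

/-- An `e`-core: a partition with no rim `e`-hooks. -/
def IsECore (e : ℕ) (f : ℕ → ℕ) : Prop := ¬ ∃ H : Finset Node1, IsRimHook1 f H ∧ H.card = e

/-! The statement. -/

open Finset

/-! ### Removing and adding nodes -/

lemma IsPartition.antitone {f : ℕ → ℕ} (hf : IsPartition f) : Antitone f :=
  antitone_nat_of_succ_le hf.1

lemma mem_Diagram {lam : Fin 2 → ℕ → ℕ} {r c : ℕ} {a : Fin 2} :
    (r, c, a) ∈ Diagram lam ↔ c < lam a r := Iff.rfl

open Classical in
lemma exists_diagram_eq_diff {lam : Fin 2 → ℕ → ℕ} (hlam : IsBipartition lam) (S : Set Node)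
    (hS : ∀ r c a, (r, c, a) ∈ S → c + 1 = lam a r ∧ lam a (r + 1) ≤ c) :
    ∃ mu, IsBipartition mu ∧ Diagram mu = Diagram lam \ S := by
  refine ⟨fun a r => if (r, lam a r - 1, a) ∈ S then lam a r - 1 else lam a r, fun a => ⟨?_, ?_⟩, ?_⟩
  · intro r
    have h1 := (hlam a).1 r
    by_cases h : (r, lam a r - 1, a) ∈ S
    · have := hS _ _ _ h
      simp only [h, if_true]
      split_ifs <;> omega
    · simp only [h, if_false]
      split_ifs <;> omega
  · obtain ⟨N, hN⟩ := (hlam a).2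
    refine ⟨N, fun r hr => ?_⟩
    have := hN r hr
    dsimp only
    split_ifs <;> omega
  · ext ⟨r, c, a⟩
    simp only [mem_Diagram, Set.mem_sdiff]
    by_cases h : (r, lam a r - 1, a) ∈ S
    · have := hS _ _ _ h
      simp only [h, if_true]
      constructor
      · intro hc
        exact ⟨by omega, fun hc' => by have := hS _ _ _ hc'; omega⟩
      · rintro ⟨h1, h2⟩
        have : c ≠ lam a r - 1 := by rintro rfl; exact h2 h
        omega
    · simp only [h, if_false]
      refine ⟨fun hc => ⟨hc, fun hc' => h ?_⟩, fun hc => hc.1⟩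
      have h2 := (hS _ _ _ hc').1
      rwa [← h2, Nat.add_sub_cancel]

open Classical in
lemma exists_diagram_eq_union {lam : Fin 2 → ℕ → ℕ} (hlam : IsBipartition lam) (S : Set Node)
    (hfin : S.Finite)
    (hS : ∀ r c a, (r, c, a) ∈ S → c = lam a r ∧ (r = 0 ∨ lam a r < lam a (r - 1))) :
    ∃ mu, IsBipartition mu ∧ Diagram mu = Diagram lam ∪ S := by
  refine ⟨fun a r => if (r, lam a r, a) ∈ S then lam a r + 1 else lam a r, fun a => ⟨?_, ?_⟩, ?_⟩
  · intro r
    have h1 := (hlam a).1 r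
    by_cases h : (r + 1, lam a (r + 1), a) ∈ S
    · have := (hS _ _ _ h).2
      simp only [h, if_true, Nat.add_sub_cancel] at this ⊢
      split_ifs <;> omega
    · simp only [h, if_false]
      split_ifs <;> omega
  · obtain ⟨N, hN⟩ := (hlam a).2
    obtain ⟨M, hM⟩ := (hfin.image Prod.fst).bddAbove
    refine ⟨max N (M + 1), fun r hr => ?_⟩
    have h0 := hN r (by omega)
    dsimp only
    rw [if_neg, h0]
    intro h
    have : r ≤ M := hM ⟨_, h, rfl⟩
    omega
  · ext ⟨r, c, a⟩
    simp only [mem_Diagram, Set.mem_union]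
    by_cases h : (r, lam a r, a) ∈ S
    · simp only [h, if_true]
      constructor
      · intro hc
        rcases Nat.lt_succ_iff_lt_or_eq.1 hc with h1 | rfl
        · exact Or.inl h1
        · exact Or.inr h
      · rintro (h1 | h1)
        · omega
        · have := (hS _ _ _ h1).1
          omega
    · simp only [h, if_false]
      refine ⟨Or.inl, ?_⟩
      rintro (h1 | h1)
      · exact h1
      · have h2 := (hS _ _ _ h1).1
        exact absurd (h2 ▸ h1) h

lemma isRemovable_iff {lam : Fin 2 → ℕ → ℕ} (hlam : IsBipartition lam) (r c : ℕ) (a : Fin 2) :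
    IsRemovable lam (r, c, a) ↔ c + 1 = lam a r ∧ lam a (r + 1) ≤ c := by
  constructor
  · rintro ⟨hx, mu, hmu, h⟩
    have hc : ¬ c < mu a r := fun h' => by
      have : (r, c, a) ∈ Diagram mu := h'
      rw [h] at this
      exact this.2 rfl
    have key : ∀ s d, (s, d, a) ≠ (r, c, a) → d < lam a s → d < mu a s := fun s d hne hd => by
      have : (s, d, a) ∈ Diagram mu := by rw [h]; exact ⟨hd, hne⟩
      exact this
    rw [mem_Diagram] at hx
    have h1 := key r (c + 1) (by simp)
    have h2 := key (r + 1) c (by simp)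
    have h3 := (hmu a).1 r
    omega
  · intro h
    refine ⟨by rw [mem_Diagram]; omega, exists_diagram_eq_diff hlam _ fun s d b hs => ?_⟩
    simp only [Set.mem_singleton_iff, Prod.mk.injEq] at hs
    obtain ⟨rfl, rfl, rfl⟩ := hs
    exact h

lemma isAddable_iff {lam : Fin 2 → ℕ → ℕ} (hlam : IsBipartition lam) (r c : ℕ) (a : Fin 2) :
    IsAddable lam (r, c, a) ↔ c = lam a r ∧ (r = 0 ∨ lam a r < lam a (r - 1)) := by
  constructor
  · rintro ⟨hx, mu, hmu, h⟩
    have hc : c < mu a r := by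
      have : (r, c, a) ∈ Diagram mu := by rw [h]; exact Or.inr rfl
      exact this
    have key : ∀ s d, (s, d, a) ≠ (r, c, a) → d < mu a s → d < lam a s := fun s d hne hd => by
      have : (s, d, a) ∈ Diagram mu := hd
      rw [h] at this
      exact this.resolve_right hne
    rw [mem_Diagram] at hx
    have h1 : c = lam a r := by
      by_contra hne
      have := key r (lam a r) (by simp; omega) (by omega)
      omega
    refine ⟨h1, ?_⟩
    rcases r with _ | r
    · exact Or.inl rfl
    · have h2 := key r c (by simp)
      have h3 := (hmu a).1 r
      simp only [Nat.add_sub_cancel]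
      omega
  · intro h
    refine ⟨by rw [mem_Diagram]; omega,
      exists_diagram_eq_union hlam _ (Set.finite_singleton _) fun s d b hs => ?_⟩
    simp only [Set.mem_singleton_iff, Prod.mk.injEq] at hs
    obtain ⟨rfl, rfl, rfl⟩ := hs
    exact h

/-! ### Counting nodes by rows -/

lemma IsBipartition.exists_bound {lam : Fin 2 → ℕ → ℕ} (hlam : IsBipartition lam) :
    ∃ N, ∀ a r, N ≤ r → lam a r = 0 := by
  obtain ⟨N₀, h₀⟩ := (hlam 0).2
  obtain ⟨N₁, h₁⟩ := (hlam 1).2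
  refine ⟨max N₀ N₁, fun a r hr => ?_⟩
  fin_cases a
  · exact h₀ r (by omega)
  · exact h₁ r (by omega)

/-- Indicator of the residue condition `z + κ_a = i`. -/
def resInd (e : ℕ) (κ : Fin 2 → ZMod e) (i : ZMod e) (a : Fin 2) (z : ZMod e) : ℤ :=
  if z + κ a = i then 1 else 0

lemma setOf_mem_Diagram_eq {e : ℕ} (κ : Fin 2 → ZMod e) {lam : Fin 2 → ℕ → ℕ} {N : ℕ}
    (hN : ∀ a r, N ≤ r → lam a r = 0) (i : ZMod e) :
    {x : Node | x ∈ Diagram lam ∧ res e κ x = i} =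
      (fun y : (_ : Fin 2) × (_ : ℕ) × ℕ => ((y.2.1, y.2.2, y.1) : Node)) ''
        ((univ.sigma fun a => (range N).sigma fun r => range (lam a r)).filter
          fun y => (y.2.2 : ZMod e) - (y.2.1 : ZMod e) + κ y.1 = i : Finset _) := by
  ext ⟨r, c, a⟩
  simp only [Set.mem_ofPred_eq, mem_Diagram, Set.mem_image, mem_coe, mem_filter, mem_sigma,
    mem_univ, mem_range, true_and, res]
  constructor
  · rintro ⟨h1, h2⟩
    refine ⟨⟨a, r, c⟩, ⟨⟨?_, h1⟩, h2⟩, rfl⟩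
    by_contra hr
    have := hN a r (not_lt.1 hr)
    omega
  · rintro ⟨⟨a, r, c⟩, ⟨⟨_, h1⟩, h2⟩, h⟩
    simp only [Prod.mk.injEq] at h
    obtain ⟨rfl, rfl, rfl⟩ := h
    exact ⟨h1, h2⟩

lemma finite_residue_nodes (e : ℕ) (κ : Fin 2 → ZMod e) {lam : Fin 2 → ℕ → ℕ}
    (hlam : IsBipartition lam) (i : ZMod e) :
    {x : Node | x ∈ Diagram lam ∧ res e κ x = i}.Finite := by
  obtain ⟨N, hN⟩ := hlam.exists_bound
  rw [setOf_mem_Diagram_eq κ hN]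
  exact (finite_toSet _).image _

lemma cnt_eq_sum {e : ℕ} (κ : Fin 2 → ZMod e) {lam : Fin 2 → ℕ → ℕ} {N : ℕ}
    (hN : ∀ a r, N ≤ r → lam a r = 0) (i : ZMod e) :
    (cnt e κ lam i : ℤ) =
      ∑ a, ∑ r ∈ range N, ∑ c ∈ range (lam a r), resInd e κ i a ((c : ZMod e) - r) := by
  rw [cnt, setOf_mem_Diagram_eq κ hN, Set.ncard_image_of_injective, Set.ncard_coe_finset,
    card_filter, sum_sigma]
  · push_cast
    simp only [sum_sigma, resInd]
  · rintro ⟨a, r, c⟩ ⟨a', r', c'⟩ h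
    simp only [Prod.mk.injEq] at h
    obtain ⟨rfl, rfl, rfl⟩ := h
    rfl

lemma ncard_image_rows (N : ℕ) (col : Fin 2 → ℕ → ℕ) (p : Fin 2 → ℕ → Prop)
    [∀ a r, Decidable (p a r)] :
    (((fun y : Fin 2 × ℕ => ((y.2, col y.1 y.2, y.1) : Node)) ''
        ((univ ×ˢ range N).filter fun y => p y.1 y.2 : Finset (Fin 2 × ℕ))).ncard : ℤ) =
      ∑ a, ∑ r ∈ range N, if p a r then 1 else 0 := by
  rw [Set.ncard_image_of_injective, Set.ncard_coe_finset, card_filter, sum_product]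
  · push_cast
    rfl
  · rintro ⟨a, r⟩ ⟨a', r'⟩ h
    simp only [Prod.mk.injEq] at h
    obtain ⟨rfl, -, rfl⟩ := h
    rfl

lemma remCount_eq_sum {e : ℕ} (κ : Fin 2 → ZMod e) {lam : Fin 2 → ℕ → ℕ}
    (hlam : IsBipartition lam) {N : ℕ} (hN : ∀ a r, N ≤ r → lam a r = 0) (i : ZMod e) :
    (remCount e κ lam i : ℤ) =
      ∑ a, ∑ r ∈ range N,
        if lam a (r + 1) < lam a r then resInd e κ i a ((lam a r : ZMod e) - 1 - r) else 0 := by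
  have h := ncard_image_rows N (fun a r => lam a r - 1)
    (fun a r => lam a (r + 1) < lam a r ∧ (lam a r : ZMod e) - 1 - r + κ a = i)
  simp only [resInd, ← ite_and] at h ⊢
  rw [← h, remCount]
  congr 2
  ext ⟨r, c, a⟩
  simp only [Set.mem_ofPred_eq, isRemovable_iff hlam, Set.mem_image, mem_coe, mem_filter,
    mem_product, mem_univ, mem_range, true_and, res]
  constructor
  · rintro ⟨⟨h1, h2⟩, h3⟩
    refine ⟨(a, r), ⟨?_, by simp only; omega, ?_⟩, ?_⟩
    · by_contra hr
      have := hN a r (not_lt.1 hr)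
      omega
    · rw [← h3, ← h1]
      push_cast
      ring
    · simp only [Prod.mk.injEq, true_and, and_true]
      omega
  · rintro ⟨⟨a, r⟩, ⟨_, h1, h2⟩, h⟩
    simp only [Prod.mk.injEq] at h h1 h2
    obtain ⟨rfl, rfl, rfl⟩ := h
    refine ⟨by omega, ?_⟩
    rw [← h2, Nat.cast_sub (by omega)]
    push_cast
    ring

lemma addCount_eq_sum {e : ℕ} (κ : Fin 2 → ZMod e) {lam : Fin 2 → ℕ → ℕ}
    (hlam : IsBipartition lam) {N : ℕ} (hN : ∀ a r, N ≤ r → lam a r = 0) (i : ZMod e) :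
    (addCount e κ lam i : ℤ) =
      ∑ a, ∑ r ∈ range (N + 1),
        if r = 0 ∨ lam a r < lam a (r - 1) then resInd e κ i a ((lam a r : ZMod e) - r)
        else 0 := by
  have h := ncard_image_rows (N + 1) lam
    (fun a r => (r = 0 ∨ lam a r < lam a (r - 1)) ∧ (lam a r : ZMod e) - r + κ a = i)
  simp only [resInd, ← ite_and] at h ⊢
  rw [← h, addCount]
  congr 2
  ext ⟨r, c, a⟩
  simp only [Set.mem_ofPred_eq, isAddable_iff hlam, Set.mem_image, mem_coe, mem_filter,
    mem_product, mem_univ, mem_range, true_and, res]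
  constructor
  · rintro ⟨⟨rfl, h2⟩, h3⟩
    refine ⟨(a, r), ⟨?_, h2, h3⟩, rfl⟩
    by_contra hr
    have := hN a (r - 1) (by omega)
    omega
  · rintro ⟨⟨a, r⟩, ⟨_, h1, h2⟩, h⟩
    simp only [Prod.mk.injEq] at h h1 h2
    obtain ⟨rfl, rfl, rfl⟩ := h
    exact ⟨⟨rfl, h1⟩, h2⟩

/-- The action of the affine Cartan matrix of type `A` on `ZMod e → ℤ`. -/
def cartan {e : ℕ} (c : ZMod e → ℤ) (l : ZMod e) : ℤ := 2 * c l - c (l + 1) - c (l - 1)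

/-- The residue content `l ↦ c_l(λ)`, with integer values. -/
noncomputable def content (e : ℕ) (κ : Fin 2 → ZMod e) (lam : Fin 2 → ℕ → ℕ) (l : ZMod e) : ℤ :=
  cnt e κ lam l

lemma resInd_add_one {e : ℕ} (κ : Fin 2 → ZMod e) (i : ZMod e) (a : Fin 2) (z : ZMod e) :
    resInd e κ (i + 1) a z = resInd e κ i a (z - 1) := by
  have : z + κ a = i + 1 ↔ z - 1 + κ a = i := by
    constructor <;> intro h <;> linear_combination h
  simp only [resInd, this]

lemma resInd_sub_one {e : ℕ} (κ : Fin 2 → ZMod e) (i : ZMod e) (a : Fin 2) (z : ZMod e) :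
    resInd e κ (i - 1) a z = resInd e κ i a (z + 1) := by
  have := resInd_add_one κ (i - 1) a (z + 1)
  rw [sub_add_cancel, add_sub_cancel_right] at this
  exact this.symm

lemma row_cartan_sum {e : ℕ} (h : ZMod e → ℤ) (n r : ℕ) :
    ∑ c ∈ range n, (2 * h ((c : ZMod e) - r) - h ((c : ZMod e) - r - 1) - h ((c : ZMod e) - r + 1)) =
      h ((n : ZMod e) - 1 - r) - h ((n : ZMod e) - r) + (h (-(r : ZMod e)) - h (-(r : ZMod e) - 1)) := by
  induction n with
  | zero =>
    simp only [range_zero, sum_empty, Nat.cast_zero, zero_sub]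
    rw [show (-1 - (r : ZMod e)) = -(r : ZMod e) - 1 by ring]
    ring
  | succ n ih =>
    rw [sum_range_succ, ih]
    push_cast
    rw [show (n : ZMod e) + 1 - 1 - r = n - r by ring, show (n : ZMod e) + 1 - r = n - r + 1 by ring,
      show (n : ZMod e) - 1 - r = n - r - 1 by ring]
    ring

lemma delta_eq_cartan {e : ℕ} (κ : Fin 2 → ZMod e) {lam : Fin 2 → ℕ → ℕ}
    (hlam : IsBipartition lam) (i : ZMod e) :
    delta e κ lam i = cartan (content e κ lam) i -
      ((if κ 0 = i then 1 else 0) + (if κ 1 = i then 1 else 0)) := by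
  obtain ⟨N, hN⟩ := hlam.exists_bound
  have hsum : ∀ a, ∑ r ∈ range N,
        (if lam a (r + 1) < lam a r then resInd e κ i a ((lam a r : ZMod e) - 1 - r) else 0) -
      ∑ r ∈ range (N + 1), (if r = 0 ∨ lam a r < lam a (r - 1) then
        resInd e κ i a ((lam a r : ZMod e) - r) else 0) =
      ∑ r ∈ range N, ∑ c ∈ range (lam a r), (2 * resInd e κ i a ((c : ZMod e) - r) -
        resInd e κ i a ((c : ZMod e) - r - 1) - resInd e κ i a ((c : ZMod e) - r + 1)) -
      resInd e κ i a 0 := by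
    intro a
    simp only [row_cartan_sum]
    have h1 : ∀ r, (if lam a (r + 1) < lam a r then
          resInd e κ i a ((lam a r : ZMod e) - 1 - r) else 0) -
        (if r + 1 = 0 ∨ lam a (r + 1) < lam a (r + 1 - 1) then
          resInd e κ i a ((lam a (r + 1) : ZMod e) - ((r + 1 : ℕ) : ZMod e)) else 0) =
        resInd e κ i a ((lam a r : ZMod e) - 1 - r) -
          resInd e κ i a ((lam a (r + 1) : ZMod e) - ((r + 1 : ℕ) : ZMod e)) := by
      intro r
      simp only [Nat.add_sub_cancel, Nat.add_eq_zero_iff, one_ne_zero, and_false, false_or]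
      split_ifs with h
      · rfl
      · have : lam a (r + 1) = lam a r := le_antisymm ((hlam a).1 r) (not_lt.1 h)
        rw [this, show (lam a r : ZMod e) - 1 - r = lam a r - ((r + 1 : ℕ) : ZMod e) by
          push_cast; ring]
        ring
    have h2 := sum_congr (rfl : range N = range N) fun r _ => h1 r
    have h3 := sum_range_sub' (fun r : ℕ => resInd e κ i a (-(r : ZMod e))) N
    have h4 := sum_range_sub' (fun r : ℕ => resInd e κ i a ((lam a r : ZMod e) - r)) N
    have h5 : ∀ r : ℕ, -(r : ZMod e) - 1 = -((r + 1 : ℕ) : ZMod e) := fun r => by push_cast; ring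
    rw [sum_range_succ']
    simp only [h5, hN a N le_rfl, sum_sub_distrib, sum_add_distrib, true_or, if_true,
      Nat.cast_zero, neg_zero, zero_sub] at h2 h3 h4 ⊢
    linarith
  rw [delta, remCount_eq_sum κ hlam hN, addCount_eq_sum κ hlam hN, ← sum_sub_distrib,
    sum_congr rfl fun a _ => hsum a]
  simp only [cartan, content, cnt_eq_sum κ hN, resInd_add_one, resInd_sub_one, sum_sub_distrib,
    ← mul_sum, Fin.sum_univ_two]
  simp only [resInd, zero_add]

/-! ### Effect on the residue content -/

lemma content_nonneg {e : ℕ} (κ : Fin 2 → ZMod e) (lam : Fin 2 → ℕ → ℕ) (l : ZMod e) :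
    0 ≤ content e κ lam l := Int.natCast_nonneg _

lemma exists_remove {e : ℕ} (κ : Fin 2 → ZMod e) {lam : Fin 2 → ℕ → ℕ} (hlam : IsBipartition lam)
    (i : ZMod e) (k : ℕ) (hk : k ≤ remCount e κ lam i) :
    ∃ mu, IsBipartition mu ∧
      content e κ mu = content e κ lam + Pi.single i (-(k : ℤ)) := by
  obtain ⟨S, hS, hcard⟩ := Set.exists_subset_card_eq hk
  obtain ⟨mu, hmu, hD⟩ := exists_diagram_eq_diff hlam S fun r c a h =>
    (isRemovable_iff hlam r c a).1 (hS h).1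
  refine ⟨mu, hmu, ?_⟩
  have hsub : S ⊆ {x : Node | x ∈ Diagram lam ∧ res e κ x = i} :=
    fun x hx => ⟨(hS hx).1.1, (hS hx).2⟩
  have hfin := finite_residue_nodes e κ hlam i
  ext l
  simp only [content, Pi.add_apply, Pi.single_apply, cnt]
  split_ifs with hl
  · subst hl
    have : {x : Node | x ∈ Diagram mu ∧ res e κ x = l} =
        {x : Node | x ∈ Diagram lam ∧ res e κ x = l} \ S := by
      ext x
      simp only [hD, Set.mem_ofPred_eq, Set.mem_sdiff]
      tauto
    rw [this, ← hcard]
    have := Set.ncard_sdiff_add_ncard_of_subset hsub hfin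
    omega
  · have : {x : Node | x ∈ Diagram mu ∧ res e κ x = l} =
        {x : Node | x ∈ Diagram lam ∧ res e κ x = l} := by
      ext x
      simp only [hD, Set.mem_ofPred_eq, Set.mem_sdiff]
      refine ⟨fun h => ⟨h.1.1, h.2⟩, fun h => ⟨⟨h.1, fun hx => hl ?_⟩, h.2⟩⟩
      rw [← h.2, (hsub hx).2]
    rw [this, add_zero]

lemma content_of_diagram_eq_union {e : ℕ} {κ : Fin 2 → ZMod e} {lam mu : Fin 2 → ℕ → ℕ}
    (hlam : IsBipartition lam) {x y : Node} (hx : x ∉ Diagram lam) (hy : y ∉ Diagram lam)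
    (hxy : res e κ x ≠ res e κ y) (hD : Diagram mu = Diagram lam ∪ {x, y}) :
    content e κ mu = content e κ lam + Pi.single (res e κ x) 1 + Pi.single (res e κ y) 1 := by
  ext l
  simp only [content, Pi.add_apply, Pi.single_apply, cnt]
  have hfin := finite_residue_nodes e κ hlam l
  have hmem : ∀ z, z ∈ {x : Node | x ∈ Diagram mu ∧ res e κ x = l} ↔
      (z ∈ {x : Node | x ∈ Diagram lam ∧ res e κ x = l} ∨ (z = x ∧ res e κ x = l) ∨
        (z = y ∧ res e κ y = l)) := by
    intro z
    simp only [hD, Set.mem_ofPred_eq, Set.mem_union, Set.mem_insert_iff, Set.mem_singleton_iff]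
    constructor
    · rintro ⟨h | rfl | rfl, h2⟩ <;> simp_all
    · rintro (h | ⟨rfl, h⟩ | ⟨rfl, h⟩) <;> simp_all
  by_cases h1 : res e κ x = l
  · have h2 : res e κ y ≠ l := fun h => hxy (h1.trans h.symm)
    have : {x : Node | x ∈ Diagram mu ∧ res e κ x = l} =
        insert x {x : Node | x ∈ Diagram lam ∧ res e κ x = l} := by
      ext z
      rw [hmem, Set.mem_insert_iff]
      tauto
    rw [this, Set.ncard_insert_of_notMem (fun h => hx h.1) hfin, if_pos h1.symm, if_neg h2.symm]
    push_cast
    ring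
  · by_cases h2 : res e κ y = l
    · have : {x : Node | x ∈ Diagram mu ∧ res e κ x = l} =
          insert y {x : Node | x ∈ Diagram lam ∧ res e κ x = l} := by
        ext z
        rw [hmem, Set.mem_insert_iff]
        tauto
      rw [this, Set.ncard_insert_of_notMem (fun h => hy h.1) hfin, if_neg (Ne.symm h1),
        if_pos h2.symm]
      push_cast
      ring
    · have : {x : Node | x ∈ Diagram mu ∧ res e κ x = l} =
          {x : Node | x ∈ Diagram lam ∧ res e κ x = l} := by
        ext z
        rw [hmem]
        tauto
      rw [this, if_neg (Ne.symm h1), if_neg (Ne.symm h2)]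
      ring

/-! ### The quadratic form -/

section Energy

variable {e : ℕ} [NeZero e]

/-- The quadratic form `Σ_l (c_l − c_{l+1})²`. -/
def energy (c : ZMod e → ℤ) : ℤ := ∑ l, (c l - c (l + 1)) ^ 2

lemma sum_mul_cartan (d c : ZMod e → ℤ) :
    ∑ l, d l * cartan c l = ∑ l, (d l - d (l + 1)) * (c l - c (l + 1)) := by
  have h1 : ∑ l, d l * (c l - c (l - 1)) = ∑ l, d (l + 1) * (c (l + 1) - c l) := by
    rw [← Equiv.sum_comp (Equiv.addRight (1 : ZMod e))]
    simp
  have h2 : ∀ l, d l * cartan c l = d l * (c l - c (l + 1)) + d l * (c l - c (l - 1)) :=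
    fun l => by rw [cartan]; ring
  simp only [h2]
  rw [sum_add_distrib, h1, ← sum_add_distrib]
  exact sum_congr rfl fun l _ => by ring

lemma energy_eq (c : ZMod e → ℤ) : energy c = ∑ l, c l * cartan c l := by
  rw [sum_mul_cartan, energy]
  exact sum_congr rfl fun l _ => by ring

lemma energy_add_single (c : ZMod e → ℤ) (he : 2 ≤ e) (i : ZMod e) (k : ℤ) :
    energy (c + Pi.single i k) = energy c + 2 * k * cartan c i + 2 * k ^ 2 := by
  have : Fact (1 < e) := ⟨by omega⟩
  have h1 : ∀ b : ZMod e → ℤ, ∑ l, (Pi.single i k : ZMod e → ℤ) l * cartan b l = k * cartan b i := by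
    intro b
    rw [sum_eq_single i]
    · simp
    · intro l _ hl
      simp [hl]
    · simp
  have h2 : cartan (Pi.single i k : ZMod e → ℤ) i = 2 * k := by
    simp [cartan]
  have h3 : energy (c + Pi.single i k) = energy c +
      2 * ∑ l, (Pi.single i k : ZMod e → ℤ) l * cartan c l + energy (Pi.single i k) := by
    rw [sum_mul_cartan, energy, energy, energy, mul_sum, ← sum_add_distrib, ← sum_add_distrib]
    refine sum_congr rfl fun l _ => ?_
    simp only [Pi.add_apply]
    ring
  rw [h3, energy_eq (Pi.single i k), h1, h1, h2]
  ring

/-- Twice the weight, as a function of the residue content. -/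
def doubleWt (κ : Fin 2 → ZMod e) (c : ZMod e → ℤ) : ℤ := 2 * (c (κ 0) + c (κ 1)) - energy c

lemma two_mul_wt (κ : Fin 2 → ZMod e) (lam : Fin 2 → ℕ → ℕ) :
    2 * wt e κ lam = doubleWt κ (content e κ lam) := by
  have : ∀ f : ZMod e → ℚ, ∑ j ∈ range e, f (j : ZMod e) = ∑ l, f l := fun f =>
    sum_nbij' (fun j => (j : ZMod e)) ZMod.val (by simp) (by simp [ZMod.val_lt])
      (fun j hj => ZMod.val_cast_of_lt (mem_range.1 hj)) (by simp) (by simp)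
  rw [wt, this fun l => ((cnt e κ lam l : ℚ) - (cnt e κ lam (l + 1) : ℚ)) ^ 2, doubleWt, energy]
  simp only [content]
  push_cast
  ring

lemma doubleWt_add_single (he : 2 ≤ e) (κ : Fin 2 → ZMod e) (c : ZMod e → ℤ) (i : ZMod e)
    (k : ℤ) :
    doubleWt κ (c + Pi.single i k) = doubleWt κ c - 2 * k * (cartan c i -
      ((if κ 0 = i then 1 else 0) + (if κ 1 = i then 1 else 0))) - 2 * k ^ 2 := by
  rw [doubleWt, energy_add_single c he, doubleWt]
  simp only [Pi.add_apply, Pi.single_apply]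
  split_ifs <;> ring

/-! ### Non-negativity of the weight -/

lemma doubleWt_nonneg_of_delta_nonpos {κ : Fin 2 → ZMod e} {lam : Fin 2 → ℕ → ℕ}
    (hlam : IsBipartition lam) (h : ∀ i, delta e κ lam i ≤ 0) :
    0 ≤ doubleWt κ (content e κ lam) := by
  have h1 : ∑ l, content e κ lam l * delta e κ lam l ≤ 0 :=
    sum_nonpos fun l _ => mul_nonpos_of_nonneg_of_nonpos (content_nonneg κ lam l) (h l)
  simp only [delta_eq_cartan κ hlam, mul_sub, mul_add, sum_sub_distrib, sum_add_distrib, mul_ite,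
    mul_one, mul_zero, sum_ite_eq, mem_univ, if_true, ← energy_eq] at h1
  have := content_nonneg κ lam (κ 0)
  have := content_nonneg κ lam (κ 1)
  rw [doubleWt]
  linarith

lemma doubleWt_nonneg (he : 2 ≤ e) (κ : Fin 2 → ZMod e) {lam : Fin 2 → ℕ → ℕ}
    (hlam : IsBipartition lam) : 0 ≤ doubleWt κ (content e κ lam) := by
  induction hn : (∑ l, content e κ lam l).toNat using Nat.strong_induction_on generalizing lam with
  | _ n ih =>
    by_cases h : ∀ i, delta e κ lam i ≤ 0
    · exact doubleWt_nonneg_of_delta_nonpos hlam h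
    · push Not at h
      obtain ⟨i, hi⟩ := h
      obtain ⟨k, hk⟩ := Int.eq_ofNat_of_zero_le hi.le
      obtain ⟨mu, hmu, hc⟩ := exists_remove κ hlam i k (by rw [delta] at hk; omega)
      have hsum : ∑ l, content e κ mu l = ∑ l, content e κ lam l - k := by
        rw [hc]
        simp [sum_add_distrib, sub_eq_add_neg]
      have hpos : 0 ≤ ∑ l, content e κ mu l := sum_nonneg fun l _ => content_nonneg κ mu l
      have h1 := ih _ (by omega) hmu rfl
      rw [hc, doubleWt_add_single he, ← delta_eq_cartan κ hlam, hk] at h1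
      linarith

end Energy

lemma cartan_add_cartan_eq_zero (c : ZMod 2 → ℤ) {i j : ZMod 2} (hij : i ≠ j) :
    cartan c i + cartan c j = 0 := by
  have h : j = i + 1 ∧ i = j + 1 ∧ i - 1 = j ∧ j - 1 = i := by decide +revert
  obtain ⟨h1, h2, h3, h4⟩ := h
  rw [cartan, cartan, h3, h4, ← h1, ← h2]
  ring

lemma neg_one_le_cartan_single {e : ℕ} (he : 3 ≤ e) {i j : ZMod e} (hij : i ≠ j) :
    -1 ≤ cartan (Pi.single i 1 : ZMod e → ℤ) j := by
  have h2 : ¬ (j + 1 = i ∧ j - 1 = i) := by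
    rintro ⟨h1, h2⟩
    have h3 : ((2 : ℕ) : ZMod e) = 0 := by
      push_cast
      linear_combination h1 - h2
    rw [ZMod.natCast_eq_zero_iff] at h3
    have := Nat.le_of_dvd (by norm_num) h3
    omega
  simp only [cartan, Pi.single_apply, hij.symm, if_false]
  split_ifs with h3 h4
  · exact absurd ⟨h3, h4⟩ h2
  all_goals norm_num

theorem stmt16 (e : ℕ) (he : 2 ≤ e) (κ : Fin 2 → ZMod e) (lam : Fin 2 → ℕ → ℕ)
    (hlam : IsBipartition lam) (hwt : wt e κ lam = 3) (i j : ZMod e) (hij : i ≠ j)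
    (hdi : 1 ≤ delta e κ lam i) (hdj : 2 ≤ delta e κ lam j) :
    ¬ ((∃ x : Node, IsAddable lam x ∧ res e κ x = i) ∧
        (∃ x : Node, IsAddable lam x ∧ res e κ x = j)) := by
  rintro ⟨⟨x, hx, hxi⟩, ⟨y, hy, hyj⟩⟩
  have : NeZero e := ⟨by omega⟩
  have h2 := two_mul_wt κ lam
  rw [hwt] at h2
  have hw : doubleWt κ (content e κ lam) = 6 := by
    have : (doubleWt κ (content e κ lam) : ℚ) = 6 := by rw [← h2]; norm_num
    exact_mod_cast this
  have hi := delta_eq_cartan κ hlam i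
  have hj := delta_eq_cartan κ hlam j
  rcases he.eq_or_lt with rfl | he3
  · have := cartan_add_cartan_eq_zero (content 2 κ lam) hij
    split_ifs at hi hj <;> linarith
  · obtain ⟨mu, hmu, hD⟩ := exists_diagram_eq_union hlam {x, y} (Set.toFinite _) (by
      rintro r c a (h | h)
      · exact (isAddable_iff hlam r c a).1 (h ▸ hx)
      · exact (isAddable_iff hlam r c a).1 (Set.mem_singleton_iff.1 h ▸ hy))
    have hc := content_of_diagram_eq_union hlam hx.1 hy.1 (by rwa [hxi, hyj]) hD
    have hnn := doubleWt_nonneg he κ hmu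
    have hcart : cartan (content e κ lam + Pi.single i 1) j =
        cartan (content e κ lam) j + cartan (Pi.single i 1 : ZMod e → ℤ) j := by
      simp only [cartan, Pi.add_apply]
      ring
    have := neg_one_le_cartan_single he3 hij
    rw [hc, hxi, hyj, doubleWt_add_single he, doubleWt_add_single he, hcart] at hnn
    linarith

end Wt3
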